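/- Let H be a real Hilbert space, V : H →L[ℝ] H a compact, self-adjoint, positive continuous linear operator, β ∈ H, and α ∈ (0,1). If (wₙ) is a sequence in H converging weakly to w ∈ H, then T_α(wₙ) → T_α(w). (Weak sequential continuity of the continuum criterion, the key analytic ingredient in the existence proof of the paper's Proposition 1.) -/

import Mathlib

open RealInnerProductSpace Filter

/-- The continuum criterion `T_α(w) = ⟪β, V w⟫² ⋅ ⟪w, V w⟫^{α/(1-α) - 1}` when
`⟪w, V w⟫ > 0`, and `0` otherwise. -/
noncomputable def Tcrit {H : Type*} [NormedAddCommGroup H] [InnerProductSpace ℝ H]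
    (V : H →L[ℝ] H) (β : H) (α : ℝ) (w : H) : ℝ :=
  if 0 < ⟪w, V w⟫ then ⟪β, V w⟫ ^ 2 * ⟪w, V w⟫ ^ (α / (1 - α) - 1) else 0

/-- A weakly convergent sequence in a Hilbert space is bounded. -/
theorem exists_norm_le_of_tendsto_inner
    {H : Type*} [NormedAddCommGroup H] [InnerProductSpace ℝ H] [CompleteSpace H]
    {w : ℕ → H} {l : H}
    (hweak : ∀ y : H, Tendsto (fun n => ⟪w n, y⟫) atTop (nhds ⟪l, y⟫)) :
    ∃ C : ℝ, ∀ n, ‖w n‖ ≤ C := by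
  obtain ⟨C, hC⟩ := banach_steinhaus (g := fun n => innerSL ℝ (w n)) fun y => by
    obtain ⟨C, hC⟩ := (hweak y).norm.bddAbove_range
    exact ⟨C, fun n => hC ⟨n, rfl⟩⟩
  exact ⟨C, fun n => by simpa using hC n⟩

/-- A compact symmetric operator maps weakly convergent sequences to norm convergent ones. -/
theorem IsCompactOperator.tendsto_of_tendsto_inner
    {H : Type*} [NormedAddCommGroup H] [InnerProductSpace ℝ H] [CompleteSpace H]
    {V : H →L[ℝ] H} (hcpt : IsCompactOperator V)
    (hsa : ∀ x y : H, ⟪V x, y⟫ = ⟪x, V y⟫) {w : ℕ → H} {l : H}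
    (hweak : ∀ y : H, Tendsto (fun n => ⟪w n, y⟫) atTop (nhds ⟪l, y⟫)) :
    Tendsto (fun n => V (w n)) atTop (nhds (V l)) := by
  obtain ⟨C, hC⟩ := exists_norm_le_of_tendsto_inner hweak
  obtain ⟨K, hK, hVK⟩ := IsCompactOperator.image_closedBall_subset_compact
    (f := V.toLinearMap) hcpt C
  refine hK.tendsto_nhds_of_unique_mapClusterPt
    (Eventually.of_forall fun n => hVK ⟨w n, by simpa using hC n, rfl⟩) fun y _ hy => ?_
  refine ext_inner_right ℝ fun z => ?_
  obtain ⟨φ, hφ, hy⟩ := hy.tendsto_subseq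
  have hlim : Tendsto (fun n => ⟪V (w n), z⟫) atTop (nhds ⟪V l, z⟫) := by
    simpa only [hsa] using hweak (V z)
  exact tendsto_nhds_unique (hy.inner tendsto_const_nhds) (hlim.comp hφ.tendsto_atTop)

/-- The quadratic form of a compact symmetric operator is weakly sequentially continuous. -/
theorem IsCompactOperator.tendsto_inner_self_of_tendsto_inner
    {H : Type*} [NormedAddCommGroup H] [InnerProductSpace ℝ H] [CompleteSpace H]
    {V : H →L[ℝ] H} (hcpt : IsCompactOperator V)
    (hsa : ∀ x y : H, ⟪V x, y⟫ = ⟪x, V y⟫) {w : ℕ → H} {l : H}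
    (hweak : ∀ y : H, Tendsto (fun n => ⟪w n, y⟫) atTop (nhds ⟪l, y⟫)) :
    Tendsto (fun n => ⟪w n, V (w n)⟫) atTop (nhds ⟪l, V l⟫) := by
  obtain ⟨C, hC⟩ := exists_norm_le_of_tendsto_inner hweak
  have hV := tendsto_iff_norm_sub_tendsto_zero.1 (hcpt.tendsto_of_tendsto_inner hsa hweak)
  have hdiff : Tendsto (fun n => ⟪w n, V (w n) - V l⟫) atTop (nhds 0) := by
    refine squeeze_zero_norm (fun n => ?_) (by simpa using hV.const_mul C)
    exact (norm_inner_le_norm _ _).trans (by gcongr; exact hC n)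
  simpa [inner_sub_right] using hdiff.add (hweak (V l))

/-- The Cauchy–Schwarz inequality for the form of a positive symmetric operator. -/
theorem inner_apply_sq_le_of_symm
    {H : Type*} [NormedAddCommGroup H] [InnerProductSpace ℝ H] {V : H →L[ℝ] H}
    (hsa : ∀ x y : H, ⟪V x, y⟫ = ⟪x, V y⟫) (hpos : ∀ x : H, 0 ≤ ⟪x, V x⟫) (x y : H) :
    ⟪x, V y⟫ ^ 2 ≤ ⟪x, V x⟫ * ⟪y, V y⟫ := by
  have hsymm : ⟪y, V x⟫ = ⟪x, V y⟫ := by rw [← hsa, real_inner_comm]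
  have hdiscrim := discrim_le_zero (a := ⟪y, V y⟫) (b := 2 * ⟪x, V y⟫) (c := ⟪x, V x⟫) fun t => by
    have h := hpos (x + t • y)
    simp only [map_add, map_smul, inner_add_left, inner_add_right, real_inner_smul_left,
      real_inner_smul_right, hsymm] at h
    linarith
  rw [discrim] at hdiscrim
  linarith

theorem Tcrit_nonneg {H : Type*} [NormedAddCommGroup H] [InnerProductSpace ℝ H]
    (V : H →L[ℝ] H) (β : H) (α : ℝ) (w : H) : 0 ≤ Tcrit V β α w := by
  unfold Tcrit
  split_ifs <;> positivity

theorem Tcrit_le {H : Type*} [NormedAddCommGroup H] [InnerProductSpace ℝ H] {V : H →L[ℝ] H}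
    (hsa : ∀ x y : H, ⟪V x, y⟫ = ⟪x, V y⟫) (hpos : ∀ x : H, 0 ≤ ⟪x, V x⟫)
    (β : H) (α : ℝ) (w : H) :
    Tcrit V β α w ≤ ⟪β, V β⟫ * ⟪w, V w⟫ ^ (α / (1 - α)) := by
  unfold Tcrit
  split_ifs with h
  · calc ⟪β, V w⟫ ^ 2 * ⟪w, V w⟫ ^ (α / (1 - α) - 1)
        ≤ ⟪β, V β⟫ * ⟪w, V w⟫ * ⟪w, V w⟫ ^ (α / (1 - α) - 1) := by
          gcongr
          exact inner_apply_sq_le_of_symm hsa hpos β w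
      _ = ⟪β, V β⟫ * ⟪w, V w⟫ ^ (α / (1 - α)) := by
          rw [Real.rpow_sub_one h.ne']
          field_simp
  · exact mul_nonneg (hpos β) (Real.rpow_nonneg (hpos w) _)

/-- Weak sequential continuity of the continuum criterion (key ingredient in the
existence proof of Proposition 1). -/
theorem continuum_criterion_weakly_continuous
    {H : Type*} [NormedAddCommGroup H] [InnerProductSpace ℝ H] [CompleteSpace H]
    (V : H →L[ℝ] H) (hcpt : IsCompactOperator V)
    (hsa : ∀ x y : H, ⟪V x, y⟫ = ⟪x, V y⟫)
    (hpos : ∀ x : H, 0 ≤ ⟪x, V x⟫)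
    (β : H) (α : ℝ) (hα : α ∈ Set.Ioo (0 : ℝ) 1)
    (w : ℕ → H) (l : H)
    (hweak : ∀ y : H, Tendsto (fun n => ⟪w n, y⟫) atTop (nhds ⟪l, y⟫)) :
    Tendsto (fun n => Tcrit V β α (w n)) atTop (nhds (Tcrit V β α l)) := by
  have hQ := hcpt.tendsto_inner_self_of_tendsto_inner hsa hweak
  rcases (hpos l).lt_or_eq with hl | hl
  · have hβ : Tendsto (fun n => ⟪β, V (w n)⟫) atTop (nhds ⟪β, V l⟫) :=
      tendsto_const_nhds.inner (hcpt.tendsto_of_tendsto_inner hsa hweak)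
    have hprod := (hβ.pow 2).mul
      (hQ.rpow_const (p := α / (1 - α) - 1) (Or.inl hl.ne'))
    rw [Tcrit, if_pos hl]
    refine hprod.congr' ?_
    filter_upwards [hQ.eventually_const_lt hl] with n hn
    rw [Tcrit, if_pos hn]
  · have hexp : 0 < α / (1 - α) := div_pos hα.1 (sub_pos.2 hα.2)
    have hbound := (hQ.rpow_const (p := α / (1 - α)) (Or.inr hexp.le)).const_mul ⟪β, V β⟫
    rw [← hl, Real.zero_rpow hexp.ne', mul_zero] at hbound
    rw [Tcrit, if_neg hl.not_lt]
    exact squeeze_zero (fun n => Tcrit_nonneg V β α (w n))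
      (fun n => Tcrit_le hsa hpos β α (w n)) hbound
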